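/- Let s > 0, 0 ≤ ε < min{s, 3/4}, and set γ(ε) = max{1/4 + (ε−s)/2, ε − 1/2, 0}. There exists C > 0 such that for all α ∈ ℝ, all M > 1, and all measurable f₁, f₂, f₃ : ℝ → ℂ with N_{s+1}(fⱼ) < ∞ (j = 1,2,3), the function g : ℝ → ℂ defined by g(ξ) = 1_{ξ>1} ∫∫_{{(ξ₁,ξ₂) : ξ₁ > ξ}} 1_{|Φ(ξ,ξ₁,ξ₂) − α| < M} (ξ₂+ξ₃) ξ₃ f₁(ξ₁) f₂(ξ₂) f₃(ξ₃) dξ₁ dξ₂ (with ξ₃ = ξ − ξ₁ − ξ₂) satisfies N_{s+ε+1}(g) ≤ C (|α| + M)^{γ(ε)} M^{1/2} N_{s+1}(f₁) N_{s+1}(f₂) N_{s+1}(f₃). -/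

import Mathlib

open MeasureTheory Real
open scoped ENNReal

/-- Japanese bracket `⟨ξ⟩ = (1+ξ²)^{1/2}`. -/
noncomputable def jap (ξ : ℝ) : ℝ := Real.sqrt (1 + ξ ^ 2)

/-- Frequency-side Sobolev norm `N_σ(f) = (∫ ⟨ξ⟩^{2σ} |f(ξ)|² dξ)^{1/2}`,
valued in `ℝ≥0∞`. -/
noncomputable def sobNorm (σ : ℝ) (f : ℝ → ℂ) : ℝ≥0∞ :=
  (∫⁻ ξ : ℝ, ENNReal.ofReal (jap ξ ^ (2 * σ)) * (‖f ξ‖₊ : ℝ≥0∞) ^ 2) ^ (1 / 2 : ℝ)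

/-- Cubic resonance function of the gauged Benjamin–Ono equation,
with `ξ₃ = ξ - ξ₁ - ξ₂`. -/
noncomputable def Φbo (ξ ξ₁ ξ₂ : ℝ) : ℝ :=
  |ξ| * ξ - |ξ₁| * ξ₁ + |ξ₂| * ξ₂ - |ξ - ξ₁ - ξ₂| * (ξ - ξ₁ - ξ₂)

lemma measurable_jap : Measurable jap := by unfold jap; fun_prop

lemma one_le_jap (x : ℝ) : 1 ≤ jap x := by
  unfold jap; exact Real.one_le_sqrt.2 (by nlinarith [sq_nonneg x])

lemma jap_pos (x : ℝ) : 0 < jap x := one_pos.trans_le (one_le_jap x)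

lemma jap_sq (x : ℝ) : jap x ^ 2 = 1 + x ^ 2 := Real.sq_sqrt (by positivity)

lemma abs_le_jap (x : ℝ) : |x| ≤ jap x := Real.abs_le_sqrt (by linarith)

lemma jap_le_jap {x y : ℝ} (h : |x| ≤ |y|) : jap x ≤ jap y :=
  Real.sqrt_le_sqrt (by linarith [sq_le_sq.2 h])

lemma jap_le_two_mul {x : ℝ} (hx : 1 ≤ x) : jap x ≤ 2 * x :=
  Real.sqrt_le_iff.2 ⟨by linarith, by nlinarith⟩

/-- The Peetre inequality. -/
lemma jap_add_le (x y : ℝ) : jap (x + y) ≤ 2 * (jap x * jap y) := by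
  refine Real.sqrt_le_iff.2 ⟨by have := jap_pos x; have := jap_pos y; positivity, ?_⟩
  rw [mul_pow, mul_pow, jap_sq, jap_sq]
  nlinarith [sq_nonneg (x - y), sq_nonneg (x * y), sq_nonneg x, sq_nonneg y]

lemma mul_abs_add_le_sub {x y : ℝ} (h : x ≤ y) : (y - x) * |x + y| ≤ |y| * y - |x| * x := by
  rcases abs_cases x with ⟨hx, _⟩ | ⟨hx, _⟩ <;> rcases abs_cases y with ⟨hy, _⟩ | ⟨hy, _⟩ <;>
    rcases abs_cases (x + y) with ⟨hz, _⟩ | ⟨hz, _⟩ <;> rw [hx, hy, hz] <;> nlinarith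

lemma sub_le_mul_abs_add_abs {x y : ℝ} (h : x ≤ y) :
    |y| * y - |x| * x ≤ (y - x) * (|x| + |y|) := by
  rcases abs_cases x with ⟨hx, _⟩ | ⟨hx, _⟩ <;> rcases abs_cases y with ⟨hy, _⟩ | ⟨hy, _⟩ <;>
    rw [hx, hy] <;> nlinarith

lemma mul_sub_le_Φbo_sub_Φbo {ξ u v t : ℝ} (hξ : 0 < ξ) (hu : ξ ≤ u) (huv : u ≤ v)
    (ht : |t| ≤ ξ / 2) : ξ * (v - u) ≤ Φbo ξ u t - Φbo ξ v t := by
  have h := sub_le_mul_abs_add_abs (x := u + t - ξ) (y := v + t - ξ) (by linarith)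
  have e₁ : |ξ - u - t| = |u + t - ξ| := by rw [abs_sub_comm]; congr 1; ring
  have e₂ : |ξ - v - t| = |v + t - ξ| := by rw [abs_sub_comm]; congr 1; ring
  have ht' := abs_le.1 ht
  have b₁ : |u + t - ξ| ≤ u - ξ / 2 := abs_le.2 ⟨by linarith, by linarith⟩
  have b₂ : |v + t - ξ| ≤ v - ξ / 2 := abs_le.2 ⟨by linarith, by linarith⟩
  unfold Φbo
  rw [e₁, e₂, abs_of_pos (by linarith : 0 < u), abs_of_pos (by linarith : 0 < v)]
  have := mul_le_mul_of_nonneg_left (add_le_add b₁ b₂) (sub_nonneg.2 huv)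
  nlinarith

lemma mul_sub_le_Φbo_sub_Φbo_right {ξ a x y : ℝ} (ha : ξ ≤ a) (hxy : x ≤ y)
    (h : ξ ≤ |x + y|) : a / 2 * (y - x) ≤ Φbo ξ a y - Φbo ξ a x := by
  have h₁ := mul_abs_add_le_sub hxy
  have h₂ := mul_abs_add_le_sub (x := a - ξ + x) (y := a - ξ + y) (by linarith)
  have e₁ : |ξ - a - x| = |a - ξ + x| := by rw [← abs_neg]; congr 1; ring
  have e₂ : |ξ - a - y| = |a - ξ + y| := by rw [← abs_neg]; congr 1; ring
  have h₃ : 2 * (a - ξ) ≤ |x + y| + |(a - ξ + x) + (a - ξ + y)| := by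
    have := neg_abs_le (x + y)
    have := le_abs_self ((a - ξ + x) + (a - ξ + y))
    have := le_abs_self (x + y)
    linarith
  have h₄ : a / 2 ≤ |x + y| + |(a - ξ + x) + (a - ξ + y)| := by
    have := abs_nonneg ((a - ξ + x) + (a - ξ + y))
    linarith
  have := mul_le_mul_of_nonneg_right h₄ (sub_nonneg.2 hxy)
  unfold Φbo
  rw [e₁, e₂]
  nlinarith

lemma volume_le_of_forall_sub_le {S : Set ℝ} {d : ℝ}
    (h : ∀ x ∈ S, ∀ y ∈ S, x ≤ y → y - x ≤ d) : volume S ≤ ENNReal.ofReal d := by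
  refine (Real.volume_le_diam S).trans (Metric.ediam_le fun x hx y hy => ?_)
  rw [edist_dist, Real.dist_eq]
  apply ENNReal.ofReal_le_ofReal
  rcases le_total x y with hxy | hxy
  · rw [abs_sub_comm, abs_of_nonneg (by linarith)]; exact h x hx y hy hxy
  · rw [abs_of_nonneg (by linarith)]; exact h y hy x hx hxy

lemma volume_resonant_fst_le {ξ t α M : ℝ} (hξ : 0 < ξ) (ht : |t| ≤ ξ / 2) :
    volume {u : ℝ | ξ < u ∧ |Φbo ξ u t - α| < M} ≤ ENNReal.ofReal (2 * M / ξ) := by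
  refine volume_le_of_forall_sub_le fun x hx y hy hxy => ?_
  have := mul_sub_le_Φbo_sub_Φbo hξ hx.1.le hxy ht
  have h₁ := abs_lt.1 hx.2
  have h₂ := abs_lt.1 hy.2
  rw [le_div_iff₀ hξ]
  nlinarith

lemma volume_resonant_snd_le {ξ a α M : ℝ} (hξ : 0 < ξ) (ha : ξ < a) :
    volume {t : ℝ | ξ / 2 < |t| ∧ |Φbo ξ a t - α| < M} ≤ ENNReal.ofReal (8 * M / a) := by
  rcases le_or_gt M 0 with hM | hM
  · rw [show {t : ℝ | ξ / 2 < |t| ∧ |Φbo ξ a t - α| < M} = ∅ by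
      ext t
      simp only [Set.mem_ofPred_eq, Set.mem_empty_iff_false, iff_false, not_and, not_lt]
      exact fun _ => hM.trans (abs_nonneg _)]
    simp
  have ha0 : 0 < a := hξ.trans ha
  have key : ∀ S : Set ℝ, (∀ x ∈ S, ∀ y ∈ S, ξ ≤ |x + y|) → (∀ x ∈ S, |Φbo ξ a x - α| < M) →
      volume S ≤ ENNReal.ofReal (4 * M / a) := by
    intro S hS hΦ
    refine volume_le_of_forall_sub_le fun x hx y hy hxy => ?_
    have := mul_sub_le_Φbo_sub_Φbo_right ha.le hxy (hS x hx y hy)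
    have h₁ := abs_lt.1 (hΦ x hx)
    have h₂ := abs_lt.1 (hΦ y hy)
    rw [le_div_iff₀ ha0]
    nlinarith
  have hsub : {t : ℝ | ξ / 2 < |t| ∧ |Φbo ξ a t - α| < M} ⊆
      {t : ℝ | ξ / 2 < t ∧ |Φbo ξ a t - α| < M} ∪ {t : ℝ | t < -(ξ / 2) ∧ |Φbo ξ a t - α| < M} := by
    rintro t ⟨h, h'⟩
    rcases lt_abs.1 h with h | h
    · exact Or.inl ⟨h, h'⟩
    · exact Or.inr ⟨by linarith, h'⟩
  refine (measure_mono hsub).trans ((measure_union_le _ _).trans ?_)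
  rw [show 8 * M / a = 4 * M / a + 4 * M / a by ring,
    ENNReal.ofReal_add (by positivity) (by positivity)]
  refine add_le_add (key _ (fun x hx y hy => ?_) fun x hx => hx.2)
    (key _ (fun x hx y hy => ?_) fun x hx => hx.2)
  · exact le_trans (by linarith [hx.1, hy.1]) (le_abs_self (x + y))
  · exact le_trans (by linarith [hx.1, hy.1]) (neg_le_abs (x + y))

/-- The multiplier of the cubic nonlinearity, relative to the Sobolev weights. -/
noncomputable def relSymbol (s ε ξ ξ₁ ξ₂ : ℝ) : ℝ :=
  |(ξ₂ + (ξ - ξ₁ - ξ₂)) * (ξ - ξ₁ - ξ₂)| * jap ξ ^ (s + ε + 1) *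
    (jap ξ₁ ^ (-(s + 1)) * jap ξ₂ ^ (-(s + 1)) * jap (ξ - ξ₁ - ξ₂) ^ (-(s + 1)))

lemma relSymbol_nonneg (s ε ξ ξ₁ ξ₂ : ℝ) : 0 ≤ relSymbol s ε ξ ξ₁ ξ₂ := by
  have := jap_pos ξ; have := jap_pos ξ₁; have := jap_pos ξ₂; have := jap_pos (ξ - ξ₁ - ξ₂)
  unfold relSymbol; positivity

lemma relSymbol_le {s ε ξ u t : ℝ} (hu : ξ < u) :
    relSymbol s ε ξ u t ≤ (u - ξ) * jap ξ ^ (s + ε + 1) * jap u ^ (-(s + 1)) *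
      jap t ^ (-(s + 1)) * jap (ξ - u - t) ^ (-s) := by
  have hξ := jap_pos ξ; have hu' := jap_pos u; have ht := jap_pos t
  have h₃ := jap_pos (ξ - u - t)
  have e : |t + (ξ - u - t)| = u - ξ := by
    rw [show t + (ξ - u - t) = -(u - ξ) by ring, abs_neg, abs_of_pos (by linarith)]
  have h : |ξ - u - t| * jap (ξ - u - t) ^ (-(s + 1)) ≤ jap (ξ - u - t) ^ (-s) := by
    rw [show -s = 1 + (-(s + 1)) by ring, Real.rpow_add h₃, Real.rpow_one]
    gcongr
    exact abs_le_jap _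
  unfold relSymbol
  rw [abs_mul, e]
  calc _ = (u - ξ) * jap ξ ^ (s + ε + 1) * jap u ^ (-(s + 1)) * jap t ^ (-(s + 1)) *
        (|ξ - u - t| * jap (ξ - u - t) ^ (-(s + 1))) := by ring
    _ ≤ _ := by
      have : 0 ≤ u - ξ := by linarith
      gcongr

lemma relSymbol_le_of_lt_abs {s ε ξ u t : ℝ} (hs : 0 ≤ s) (hξ : 0 < ξ) (hu : ξ < u)
    (ht : ξ / 2 < |t|) :
    relSymbol s ε ξ u t ≤ 2 ^ (s + 1) * jap ξ ^ ε * jap u ^ (-s) := by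
  have hξ' := jap_pos ξ; have hu' := jap_pos u; have ht' := jap_pos t
  have h₃ := one_le_jap (ξ - u - t)
  refine (relSymbol_le hu).trans ?_
  have h1 : jap (ξ - u - t) ^ (-s) ≤ 1 := Real.rpow_le_one_of_one_le_of_nonpos h₃ (by linarith)
  have h2 : u - ξ ≤ jap u := le_trans (by linarith) ((le_abs_self u).trans (abs_le_jap u))
  have h3 : jap ξ ≤ 2 * jap t := by
    refine Real.sqrt_le_iff.2 ⟨by positivity, ?_⟩
    rw [mul_pow, jap_sq, ← sq_abs t]
    nlinarith
  have h4 : jap t ^ (-(s + 1)) ≤ 2 ^ (s + 1) * jap ξ ^ (-(s + 1)) := by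
    have := Real.rpow_le_rpow_of_nonpos (by positivity) (show jap ξ / 2 ≤ jap t by linarith)
      (show -(s + 1) ≤ 0 by linarith)
    refine this.trans_eq ?_
    rw [Real.div_rpow hξ'.le (by norm_num), Real.rpow_neg (by norm_num : (0 : ℝ) ≤ 2),
      div_inv_eq_mul, mul_comm]
  calc _ ≤ jap u * jap ξ ^ (s + ε + 1) * jap u ^ (-(s + 1)) *
        (2 ^ (s + 1) * jap ξ ^ (-(s + 1))) * 1 := by
        gcongr
    _ = 2 ^ (s + 1) * (jap ξ ^ (s + ε + 1) * jap ξ ^ (-(s + 1))) *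
          (jap u ^ (1 : ℝ) * jap u ^ (-(s + 1))) := by rw [Real.rpow_one]; ring
    _ = _ := by
      rw [← Real.rpow_add hξ', ← Real.rpow_add hu']
      congr 2 <;> ring_nf

lemma nonresonant_bound {s ε γ a b p q A : ℝ} (hs : 0 ≤ s) (hγ0 : 0 ≤ γ) (hγ1 : γ ≤ 1)
    (h₁ : ε - 1 / 2 ≤ γ) (h₂ : 1 / 2 + ε - s ≤ 2 * γ) (ha : 0 < a) (hb : 1 ≤ b) (hab : a ≤ b)
    (hp : 1 ≤ p) (hpq : p ≤ q) (haq : a ≤ q) (hA : a * p ≤ A) :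
    a * b ^ (-s) * p ^ (ε - 1 / 2) * (p / q) ^ (s + 1) ≤ A ^ γ := by
  have hp0 : 0 < p := by linarith
  have hq0 : 0 < q := by linarith
  refine le_trans ?_ (Real.rpow_le_rpow (by positivity) hA hγ0)
  have hpq1 : (p / q) ^ (s + 1) ≤ 1 :=
    Real.rpow_le_one (by positivity) ((div_le_one hq0).2 hpq) (by linarith)
  rw [Real.mul_rpow ha.le hp0.le]
  rcases le_total a 1 with h | h
  · have e1 : b ^ (-s) ≤ 1 := Real.rpow_le_one_of_one_le_of_nonpos hb (by linarith)
    have e2 : a ≤ a ^ γ := by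
      simpa using Real.rpow_le_rpow_of_exponent_ge ha h hγ1
    have e3 : p ^ (ε - 1 / 2) ≤ p ^ γ := Real.rpow_le_rpow_of_exponent_le hp h₁
    calc _ ≤ a ^ γ * 1 * p ^ γ * 1 := by gcongr
      _ = _ := by ring
  have e1 : a * b ^ (-s) ≤ a ^ (1 - s) := by
    rw [sub_eq_add_neg, Real.rpow_add ha, Real.rpow_one]
    exact mul_le_mul_of_nonneg_left (Real.rpow_le_rpow_of_nonpos ha hab (by linarith)) ha.le
  rcases le_total a p with h' | h'
  · have hpa : 1 ≤ p / a := (one_le_div ha).2 h'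
    calc _ ≤ a ^ (1 - s) * p ^ (ε - 1 / 2) * 1 := by gcongr
      _ = (p / a) ^ (ε - 1 / 2) * a ^ (1 / 2 + ε - s) := by
        rw [Real.div_rpow hp0.le ha.le, show 1 / 2 + ε - s = (1 - s) + (ε - 1 / 2) by ring,
          Real.rpow_add ha]
        field_simp
      _ ≤ (p / a) ^ γ * a ^ (2 * γ) := by
        gcongr
      _ = _ := by
        rw [Real.div_rpow hp0.le ha.le, two_mul, Real.rpow_add ha]
        field_simp
  · calc _ ≤ a ^ (1 - s) * p ^ (ε - 1 / 2) * (p / a) ^ (s + 1) := by gcongr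
      _ = a ^ (-(2 * s)) * p ^ (s + ε + 1 / 2) := by
        rw [Real.div_rpow hp0.le ha.le, show -(2 * s) = (1 - s) - (s + 1) by ring,
          Real.rpow_sub ha (1 - s), show s + ε + 1 / 2 = (ε - 1 / 2) + (s + 1) by ring,
          Real.rpow_add hp0 (ε - 1 / 2)]
        ring
      _ ≤ p ^ (-(2 * s)) * p ^ (s + ε + 1 / 2) := by
        gcongr ?_ * _
        exact Real.rpow_le_rpow_of_nonpos hp0 h' (by linarith)
      _ = p ^ (1 / 2 + ε - s) := by rw [← Real.rpow_add hp0]; congr 1; ring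
      _ ≤ p ^ (2 * γ) := Real.rpow_le_rpow_of_exponent_le hp h₂
      _ = p ^ γ * p ^ γ := by rw [two_mul, Real.rpow_add hp0]
      _ ≤ _ := by gcongr

lemma lintegral_mul_sq_le {X : Type*} [MeasurableSpace X] (μ : Measure X) {f g : X → ℝ≥0∞}
    (hf : AEMeasurable f μ) (hg : AEMeasurable g μ) :
    (∫⁻ x, f x * g x ∂μ) ^ 2 ≤ (∫⁻ x, f x ^ 2 ∂μ) * ∫⁻ x, g x ^ 2 ∂μ := by
  have h := ENNReal.lintegral_mul_le_Lp_mul_Lq μ Real.HolderConjugate.two_two hf hg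
  simp only [Pi.mul_apply, ENNReal.rpow_ofNat] at h
  calc _ ≤ _ := pow_le_pow_left' h 2
    _ = _ := by
      rw [mul_pow, ← ENNReal.rpow_natCast, ← ENNReal.rpow_natCast, ← ENNReal.rpow_mul,
        ← ENNReal.rpow_mul]
      norm_num

/-- If a trilinear multiplier is square integrable in the input frequencies, uniformly in the
output frequency, then it is bounded `L² × L² × L² → L²`. -/
lemma lintegral_sq_trilinear_le {k : ℝ → ℝ → ℝ → ℝ≥0∞}
    (hk : ∀ ξ, Measurable (Function.uncurry (k ξ))) {F₁ F₂ F₃ : ℝ → ℝ≥0∞}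
    (h₁ : Measurable F₁) (h₂ : Measurable F₂) (h₃ : Measurable F₃) {B : ℝ≥0∞}
    (hB : ∀ ξ, ∫⁻ ξ₁, ∫⁻ ξ₂, k ξ ξ₁ ξ₂ ^ 2 ≤ B) :
    ∫⁻ ξ, (∫⁻ ξ₁, ∫⁻ ξ₂, k ξ ξ₁ ξ₂ * (F₁ ξ₁ * F₂ ξ₂ * F₃ (ξ - ξ₁ - ξ₂))) ^ 2 ≤
      B * ((∫⁻ x, F₁ x ^ 2) * (∫⁻ x, F₂ x ^ 2) * ∫⁻ x, F₃ x ^ 2) := by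
  have step : ∀ ξ, (∫⁻ ξ₁, ∫⁻ ξ₂, k ξ ξ₁ ξ₂ * (F₁ ξ₁ * F₂ ξ₂ * F₃ (ξ - ξ₁ - ξ₂))) ^ 2 ≤
      B * ∫⁻ ξ₁, ∫⁻ ξ₂, (F₁ ξ₁ * F₂ ξ₂ * F₃ (ξ - ξ₁ - ξ₂)) ^ 2 := by
    intro ξ
    have hF : Measurable fun z : ℝ × ℝ => F₁ z.1 * F₂ z.2 * F₃ (ξ - z.1 - z.2) := by fun_prop
    have hk' : Measurable fun z : ℝ × ℝ => k ξ z.1 z.2 := hk ξ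
    have := lintegral_mul_sq_le ((volume : Measure ℝ).prod (volume : Measure ℝ))
      hk'.aemeasurable hF.aemeasurable
    rw [lintegral_prod (fun z : ℝ × ℝ => k ξ z.1 z.2 * (F₁ z.1 * F₂ z.2 * F₃ (ξ - z.1 - z.2)))
        (hk'.mul hF).aemeasurable, lintegral_prod _ (hk'.pow_const 2).aemeasurable,
      lintegral_prod _ (hF.pow_const 2).aemeasurable] at this
    exact this.trans (by gcongr; exact hB ξ)
  refine (lintegral_mono step).trans ?_
  rw [lintegral_const_mul]
  swap
  · refine Measurable.lintegral_prod_right' (f := fun w : ℝ × ℝ =>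
      ∫⁻ ξ₂, (F₁ w.2 * F₂ ξ₂ * F₃ (w.1 - w.2 - ξ₂)) ^ 2) ?_
    refine Measurable.lintegral_prod_right' (f := fun w : (ℝ × ℝ) × ℝ =>
      (F₁ w.1.2 * F₂ w.2 * F₃ (w.1.1 - w.1.2 - w.2)) ^ 2) ?_
    fun_prop
  gcongr
  apply le_of_eq
  rw [lintegral_lintegral_swap]
  swap
  · refine (Measurable.lintegral_prod_right' (f := fun w : (ℝ × ℝ) × ℝ =>
      (F₁ w.1.2 * F₂ w.2 * F₃ (w.1.1 - w.1.2 - w.2)) ^ 2) ?_).aemeasurable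
    fun_prop
  have inner : ∀ ξ₁, ∫⁻ ξ, ∫⁻ ξ₂, (F₁ ξ₁ * F₂ ξ₂ * F₃ (ξ - ξ₁ - ξ₂)) ^ 2 =
      F₁ ξ₁ ^ 2 * ((∫⁻ x, F₂ x ^ 2) * ∫⁻ x, F₃ x ^ 2) := by
    intro ξ₁
    rw [lintegral_lintegral_swap (by
      refine Measurable.aemeasurable ?_
      unfold Function.uncurry
      fun_prop)]
    have : ∀ ξ₂, ∫⁻ ξ, (F₁ ξ₁ * F₂ ξ₂ * F₃ (ξ - ξ₁ - ξ₂)) ^ 2 =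
        F₁ ξ₁ ^ 2 * (F₂ ξ₂ ^ 2 * ∫⁻ x, F₃ x ^ 2) := by
      intro ξ₂
      simp_rw [mul_pow]
      rw [lintegral_const_mul _ (by fun_prop), mul_assoc]
      congr 2
      simp_rw [sub_sub]
      exact lintegral_sub_right_eq_self (fun x => F₃ x ^ 2) (ξ₁ + ξ₂)
    simp_rw [this]
    rw [lintegral_const_mul _ (by fun_prop), lintegral_mul_const _ (by fun_prop)]
  simp_rw [inner]
  rw [lintegral_mul_const _ (by fun_prop), mul_assoc]

lemma ofReal_jap_rpow_two_mul (σ x : ℝ) :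
    ENNReal.ofReal (jap x ^ (2 * σ)) = ENNReal.ofReal (jap x ^ σ) ^ 2 := by
  rw [← ENNReal.ofReal_pow (Real.rpow_nonneg (jap_pos x).le _), mul_comm,
    Real.rpow_mul (jap_pos x).le]
  norm_cast

lemma sobNorm_eq (σ : ℝ) (f : ℝ → ℂ) :
    sobNorm σ f = (∫⁻ x, (ENNReal.ofReal (jap x ^ σ) * ‖f x‖ₑ) ^ 2) ^ (1 / 2 : ℝ) := by
  unfold sobNorm
  simp_rw [ofReal_jap_rpow_two_mul, mul_pow]
  rfl

lemma enorm_mul_eq_ofReal_relSymbol (s ε ξ u t : ℝ) (z₁ z₂ z₃ : ℂ) :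
    ENNReal.ofReal (jap ξ ^ (s + ε + 1)) *
      ‖(((t + (ξ - u - t)) * (ξ - u - t) : ℝ) : ℂ) * z₁ * z₂ * z₃‖ₑ =
    ENNReal.ofReal (relSymbol s ε ξ u t) * (ENNReal.ofReal (jap u ^ (s + 1)) * ‖z₁‖ₑ *
      (ENNReal.ofReal (jap t ^ (s + 1)) * ‖z₂‖ₑ) *
      (ENNReal.ofReal (jap (ξ - u - t) ^ (s + 1)) * ‖z₃‖ₑ)) := by
  have hξ := jap_pos ξ; have hu := jap_pos u; have ht := jap_pos t
  have h₃ := jap_pos (ξ - u - t)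
  simp only [← ofReal_norm]
  rw [norm_mul, norm_mul, norm_mul, Complex.norm_real, Real.norm_eq_abs]
  have := relSymbol_nonneg s ε ξ u t
  repeat rw [← ENNReal.ofReal_mul (by positivity)]
  congr 1
  unfold relSymbol
  rw [Real.rpow_neg hu.le, Real.rpow_neg ht.le, Real.rpow_neg h₃.le]
  have := Real.rpow_pos_of_pos hu (s + 1)
  have := Real.rpow_pos_of_pos ht (s + 1)
  have := Real.rpow_pos_of_pos h₃ (s + 1)
  generalize (t + (ξ - u - t)) * (ξ - u - t) = w
  field_simp

lemma measurable_Φbo (ξ : ℝ) : Measurable fun z : ℝ × ℝ => Φbo ξ z.1 z.2 := by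
  unfold Φbo
  exact Continuous.measurable (by fun_prop)

lemma measurable_relSymbol (s ε ξ : ℝ) : Measurable fun z : ℝ × ℝ => relSymbol s ε ξ z.1 z.2 := by
  have h := measurable_jap
  unfold relSymbol
  have h₁ : Measurable fun z : ℝ × ℝ =>
      |(z.2 + (ξ - z.1 - z.2)) * (ξ - z.1 - z.2)| := Continuous.measurable (by fun_prop)
  fun_prop

lemma mul_sub_le_of_abs_Φbo_le {ξ u t A : ℝ} (hξ : 0 < ξ) (hu : ξ < u) (ht : |t| ≤ ξ / 2)
    (hΦ : |Φbo ξ u t| ≤ A) : ξ * (u - ξ) ≤ A + 2 * t ^ 2 := by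
  have h := mul_sub_le_Φbo_sub_Φbo hξ le_rfl hu.le ht
  have e : Φbo ξ ξ t = 2 * (|t| * t) := by
    unfold Φbo
    rw [show ξ - ξ - t = -t by ring, abs_neg]; ring
  have h₂ : |t| * t ≤ t ^ 2 := by
    rw [← sq_abs t, sq]
    exact mul_le_mul_of_nonneg_left (le_abs_self t) (abs_nonneg t)
  have := neg_abs_le (Φbo ξ u t)
  linarith

lemma relSymbol_le_of_two_mul_sq_le {s ε γ ξ u t A : ℝ} (hs : 0 ≤ s) (hγ0 : 0 ≤ γ) (hγ1 : γ ≤ 1)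
    (h₁ : ε - 1 / 2 ≤ γ) (h₂ : 1 / 2 + ε - s ≤ 2 * γ) (hξ : 1 ≤ ξ) (hu : ξ < u)
    (ht : |t| ≤ ξ / 2) (hΦ : |Φbo ξ u t| ≤ A) (htA : 2 * t ^ 2 ≤ A) :
    relSymbol s ε ξ u t ≤ 2 ^ s * (jap t)⁻¹ * jap ξ ^ (1 / 2 : ℝ) * (4 * A) ^ γ := by
  have hp := jap_pos ξ; have hq := jap_pos u; have hτ := jap_pos t
  have hσ := jap_pos (ξ - u - t)
  have hb := jap_pos (u - ξ)
  have ha : 0 < u - ξ := by linarith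
  have hA : (u - ξ) * jap ξ ≤ 4 * A := by
    have := mul_sub_le_of_abs_Φbo_le (by linarith) hu ht hΦ
    have := mul_le_mul_of_nonneg_left (jap_le_two_mul hξ) ha.le
    linarith
  have main := nonresonant_bound hs hγ0 hγ1 h₁ h₂ ha (one_le_jap (u - ξ))
    ((le_abs_self _).trans (abs_le_jap _)) (one_le_jap ξ)
    (jap_le_jap (by rw [abs_of_pos (by linarith), abs_of_pos (by linarith)]; exact hu.le))
    (le_trans (by linarith) ((le_abs_self u).trans (abs_le_jap u))) hA
  have peetre : (jap t * jap (ξ - u - t)) ^ (-s) ≤ 2 ^ s * jap (u - ξ) ^ (-s) := by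
    have h := jap_add_le t (ξ - u - t)
    rw [show t + (ξ - u - t) = -(u - ξ) by ring] at h
    have e : jap (-(u - ξ)) = jap (u - ξ) := by unfold jap; rw [neg_sq]
    rw [e] at h
    refine (Real.rpow_le_rpow_of_nonpos (by positivity)
      (show jap (u - ξ) / 2 ≤ jap t * jap (ξ - u - t) by linarith)
      (show -s ≤ 0 by linarith)).trans_eq ?_
    rw [Real.div_rpow hb.le (by norm_num), Real.rpow_neg (by norm_num : (0 : ℝ) ≤ 2),
      div_inv_eq_mul, mul_comm]
  calc relSymbol s ε ξ u t ≤ _ := relSymbol_le hu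
    _ = (jap t)⁻¹ * jap ξ ^ (1 / 2 : ℝ) * ((u - ξ) * jap ξ ^ (ε - 1 / 2) *
          (jap ξ / jap u) ^ (s + 1)) * (jap t * jap (ξ - u - t)) ^ (-s) := by
      rw [Real.div_rpow hp.le hq.le, Real.mul_rpow hτ.le hσ.le, Real.rpow_neg hq.le,
        show -(s + 1) = -1 + -s by ring, Real.rpow_add hτ, Real.rpow_neg_one,
        show s + ε + 1 = 1 / 2 + (ε - 1 / 2) + (s + 1) by ring, Real.rpow_add hp,
        Real.rpow_add hp]
      ring
    _ ≤ (jap t)⁻¹ * jap ξ ^ (1 / 2 : ℝ) * ((u - ξ) * jap ξ ^ (ε - 1 / 2) *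
          (jap ξ / jap u) ^ (s + 1)) * (2 ^ s * jap (u - ξ) ^ (-s)) := by gcongr
    _ = 2 ^ s * (jap t)⁻¹ * jap ξ ^ (1 / 2 : ℝ) * ((u - ξ) * jap (u - ξ) ^ (-s) *
          jap ξ ^ (ε - 1 / 2) * (jap ξ / jap u) ^ (s + 1)) := by ring
    _ ≤ _ := by gcongr

lemma relSymbol_le_of_le_two_mul_sq {s ε σ ξ u t A : ℝ} (hs : 0 ≤ s) (hσs : σ ≤ s)
    (hσ1 : σ ≤ 1) (hεσ : ε ≤ σ) (hξ : 1 ≤ ξ) (hu : ξ < u)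
    (ht : |t| ≤ ξ / 2) (hΦ : |Φbo ξ u t| ≤ A) (htA : A ≤ 2 * t ^ 2) :
    relSymbol s ε ξ u t ≤ 8 := by
  have hp := jap_pos ξ; have hq := jap_pos u; have hτ := jap_pos t
  have hp1 := one_le_jap ξ
  have ha : 0 < u - ξ := by linarith
  have hA : u - ξ ≤ 8 * jap t ^ 2 / jap ξ := by
    have := mul_sub_le_of_abs_Φbo_le (by linarith) hu ht hΦ
    have := mul_le_mul_of_nonneg_left (jap_le_two_mul hξ) ha.le
    rw [le_div_iff₀ hp, jap_sq]
    linarith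
  have hpq : jap ξ ≤ jap u :=
    jap_le_jap (by rw [abs_of_pos (by linarith), abs_of_pos (by linarith)]; exact hu.le)
  have hτp : jap t ≤ jap ξ := jap_le_jap (by rw [abs_of_pos (a := ξ) (by linarith)]; linarith)
  have h₃ : jap (ξ - u - t) ^ (-s) ≤ 1 :=
    Real.rpow_le_one_of_one_le_of_nonpos (one_le_jap _) (by linarith)
  have hq' : jap u ^ (-(s + 1)) ≤ jap ξ ^ (-(s + 1)) :=
    Real.rpow_le_rpow_of_nonpos hp hpq (by linarith)
  have hτ' : jap t ^ (1 - s) ≤ jap ξ ^ (1 - σ) :=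
    (Real.rpow_le_rpow_of_exponent_le (one_le_jap t) (by linarith)).trans
      (Real.rpow_le_rpow hτ.le hτp (by linarith))
  calc relSymbol s ε ξ u t ≤ _ := relSymbol_le hu
    _ ≤ 8 * jap t ^ 2 / jap ξ * jap ξ ^ (s + ε + 1) * jap ξ ^ (-(s + 1)) *
        jap t ^ (-(s + 1)) * 1 := by
      have := jap_pos (ξ - u - t)
      gcongr
    _ = 8 * jap t ^ (1 - s) * jap ξ ^ (ε - 1) := by
      rw [show 1 - s = 2 + -(s + 1) by ring, Real.rpow_add hτ,
        show ε - 1 = -1 + ((s + ε + 1) + -(s + 1)) by ring, Real.rpow_add hp (-1),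
        Real.rpow_add hp (s + ε + 1),
        Real.rpow_neg_one, Real.rpow_ofNat]
      ring
    _ ≤ 8 * jap ξ ^ (1 - σ) * jap ξ ^ (ε - 1) := by gcongr
    _ = 8 * jap ξ ^ (ε - σ) := by
      rw [mul_assoc, ← Real.rpow_add hp]; congr 2; ring
    _ ≤ 8 * 1 := by
      gcongr
      exact Real.rpow_le_one_of_one_le_of_nonpos hp1 (by linarith)
    _ = 8 := by norm_num

lemma relSymbol_sq_le_of_abs_le {s ε γ σ ξ u t A : ℝ} (hs : 0 ≤ s) (hγ0 : 0 ≤ γ) (hγ1 : γ ≤ 1)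
    (h₁ : ε - 1 / 2 ≤ γ) (h₂ : 1 / 2 + ε - s ≤ 2 * γ) (hσs : σ ≤ s) (hσ1 : σ ≤ 1) (hεσ : ε ≤ σ)
    (hξ : 1 ≤ ξ) (hu : ξ < u) (ht : |t| ≤ ξ / 2) (hA : 0 ≤ A) (hΦ : |Φbo ξ u t| ≤ A) :
    relSymbol s ε ξ u t ^ 2 ≤ 2 * 4 ^ s * (4 * A) ^ (2 * γ) * ξ * (1 + t ^ 2)⁻¹ + 64 := by
  have h0 := relSymbol_nonneg s ε ξ u t
  rcases le_total (2 * t ^ 2) A with h | h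
  · have hm := relSymbol_le_of_two_mul_sq_le hs hγ0 hγ1 h₁ h₂ hξ hu ht hΦ h
    have hp := jap_pos ξ; have hτ := jap_pos t
    calc _ ≤ (2 ^ s * (jap t)⁻¹ * jap ξ ^ (1 / 2 : ℝ) * (4 * A) ^ γ) ^ 2 := by gcongr
      _ = 4 ^ s * (4 * A) ^ (2 * γ) * jap ξ * (1 + t ^ 2)⁻¹ := by
        have e₁ : ((2 : ℝ) ^ s) ^ 2 = 4 ^ s := by
          rw [← Real.rpow_mul_natCast (by norm_num), mul_comm, Real.rpow_mul (by norm_num)]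
          norm_num
        have e₂ : (jap ξ ^ (1 / 2 : ℝ)) ^ 2 = jap ξ := by
          rw [← Real.rpow_mul_natCast hp.le]; norm_num
        have e₃ : ((4 * A) ^ γ) ^ 2 = (4 * A) ^ (2 * γ) := by
          rw [← Real.rpow_mul_natCast (by positivity), mul_comm γ]; norm_num
        rw [mul_pow, mul_pow, mul_pow, e₁, e₂, e₃, inv_pow, jap_sq]
        ring
      _ ≤ 4 ^ s * (4 * A) ^ (2 * γ) * (2 * ξ) * (1 + t ^ 2)⁻¹ := by
        gcongr
        exact jap_le_two_mul hξ
      _ ≤ _ := by linarith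
  · have hm := relSymbol_le_of_le_two_mul_sq hs hσs hσ1 hεσ hξ hu ht hΦ h
    have : 0 ≤ 2 * 4 ^ s * (4 * A) ^ (2 * γ) * ξ * (1 + t ^ 2)⁻¹ := by positivity
    nlinarith

lemma relSymbol_sq_mul_le {s ε ξ u M : ℝ} (hs : 0 ≤ s) (hε : 0 ≤ ε) (hM : 0 ≤ M)
    (hξ : 1 ≤ ξ) (hu : ξ < u) :
    (2 ^ (s + 1) * jap ξ ^ ε * jap u ^ (-s)) ^ 2 * (8 * M / u) ≤
      8 * 4 ^ (s + 1) * 4 ^ ε * M * ξ ^ (2 * ε) * u ^ (-(2 * s) - 1) := by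
  have hp := jap_pos ξ
  have hu0 : 0 < u := by linarith
  have h₁ : jap u ^ (-s) ≤ u ^ (-s) :=
    Real.rpow_le_rpow_of_nonpos hu0 ((le_abs_self u).trans (abs_le_jap u)) (by linarith)
  have h₂ : jap ξ ^ ε ≤ (2 * ξ) ^ ε := Real.rpow_le_rpow hp.le (jap_le_two_mul hξ) hε
  have hq := jap_pos u
  have e : ∀ r : ℝ, ((2 : ℝ) ^ r) ^ 2 = 4 ^ r := fun r => by
    rw [← Real.rpow_mul_natCast (by norm_num), mul_comm, Real.rpow_mul (by norm_num)]
    norm_num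
  calc _ ≤ (2 ^ (s + 1) * (2 * ξ) ^ ε * u ^ (-s)) ^ 2 * (8 * M / u) := by gcongr
    _ = _ := by
      rw [Real.mul_rpow (by norm_num) (by linarith), mul_pow, mul_pow, mul_pow, e, e,
        ← Real.rpow_mul_natCast (by linarith : 0 ≤ ξ), ← Real.rpow_mul_natCast hu0.le,
        Real.rpow_sub_one hu0.ne']
      push_cast
      rw [show -s * 2 = -(2 * s) by ring, mul_comm ε 2]
      ring

/-- The contribution of `|ξ₂| ≤ ξ / 2`, where the phase is transversal in `ξ₁`. -/
lemma lintegral_relSymbol_low_le {s ε γ σ ξ α M : ℝ} (hs : 0 ≤ s) (hγ0 : 0 ≤ γ) (hγ1 : γ ≤ 1)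
    (h₁ : ε - 1 / 2 ≤ γ) (h₂ : 1 / 2 + ε - s ≤ 2 * γ) (hσs : σ ≤ s) (hσ1 : σ ≤ 1) (hεσ : ε ≤ σ)
    (hξ : 1 ≤ ξ) (hM : 0 ≤ M) :
    ∫⁻ u, ∫⁻ t, (if |t| ≤ ξ / 2 ∧ ξ < u ∧ |Φbo ξ u t - α| < M then
      ENNReal.ofReal (relSymbol s ε ξ u t ^ 2) else 0) ≤
    ENNReal.ofReal (4 * π * 4 ^ s * (4 * (|α| + M)) ^ (2 * γ) * M + 128 * M) := by
  set A := |α| + M with hA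
  have hA0 : 0 ≤ A := by positivity
  have hξ0 : 0 < ξ := by linarith
  set E := 2 * 4 ^ s * (4 * A) ^ (2 * γ) with hE
  have hE0 : 0 ≤ E := by positivity
  have hΦm := measurable_Φbo ξ
  have hSm := measurable_relSymbol s ε ξ
  rw [lintegral_lintegral_swap]
  swap
  · refine Measurable.aemeasurable ?_
    refine Measurable.ite ?_ (hSm.pow_const 2).ennreal_ofReal measurable_const
    refine MeasurableSet.inter (s₁ := {z : ℝ × ℝ | |z.2| ≤ ξ / 2}) ?_
      (MeasurableSet.inter (s₁ := {z : ℝ × ℝ | ξ < z.1})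
        (s₂ := {z : ℝ × ℝ | |Φbo ξ z.1 z.2 - α| < M}) ?_ ?_)
    · exact (isClosed_le (by fun_prop) (by fun_prop)).measurableSet
    · exact (isOpen_lt (by fun_prop) (by fun_prop)).measurableSet
    · exact measurableSet_lt (continuous_abs.measurable.comp (hΦm.sub_const α)) measurable_const
  have inner : ∀ t, ∫⁻ u, (if |t| ≤ ξ / 2 ∧ ξ < u ∧ |Φbo ξ u t - α| < M then
      ENNReal.ofReal (relSymbol s ε ξ u t ^ 2) else 0) ≤
      ENNReal.ofReal (2 * M * E * (1 + t ^ 2)⁻¹) +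
        (Set.Icc (-(ξ / 2)) (ξ / 2)).indicator (fun _ => ENNReal.ofReal (128 * M / ξ)) t := by
    intro t
    by_cases ht : |t| ≤ ξ / 2
    · calc _ ≤ ∫⁻ u, {u : ℝ | ξ < u ∧ |Φbo ξ u t - α| < M}.indicator
            (fun _ => ENNReal.ofReal (E * ξ * (1 + t ^ 2)⁻¹ + 64)) u := by
            refine lintegral_mono fun u => ?_
            dsimp only
            split_ifs with h
            · rw [Set.indicator_of_mem (show u ∈ {u : ℝ | ξ < u ∧ |Φbo ξ u t - α| < M} from h.2)]
              apply ENNReal.ofReal_le_ofReal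
              refine relSymbol_sq_le_of_abs_le hs hγ0 hγ1 h₁ h₂ hσs hσ1 hεσ hξ h.2.1 ht hA0 ?_
              have := abs_add_le (Φbo ξ u t - α) α
              rw [sub_add_cancel] at this
              linarith [h.2.2]
            · exact zero_le
        _ ≤ ENNReal.ofReal (E * ξ * (1 + t ^ 2)⁻¹ + 64) *
            volume {u : ℝ | ξ < u ∧ |Φbo ξ u t - α| < M} := lintegral_indicator_const_le _ _
        _ ≤ ENNReal.ofReal (E * ξ * (1 + t ^ 2)⁻¹ + 64) * ENNReal.ofReal (2 * M / ξ) := by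
            gcongr
            exact volume_resonant_fst_le hξ0 ht
        _ = _ := by
            rw [Set.indicator_of_mem (Set.mem_Icc.2 (abs_le.1 ht)),
              ← ENNReal.ofReal_mul (by positivity), ← ENNReal.ofReal_add (by positivity)
                (by positivity)]
            congr 1
            field_simp
            ring
    · simp [ht]
  refine (lintegral_mono inner).trans ?_
  have e₁ : ∫⁻ t : ℝ, ENNReal.ofReal (2 * M * E * (1 + t ^ 2)⁻¹) =
      ENNReal.ofReal (2 * M * E * π) := by
    rw [← ofReal_integral_eq_lintegral_ofReal (integrable_inv_one_add_sq.const_mul _)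
      (Filter.Eventually.of_forall fun t => by positivity), integral_const_mul,
      integral_univ_inv_one_add_sq]
  rw [lintegral_add_left (by fun_prop), e₁, lintegral_indicator_const measurableSet_Icc,
    Real.volume_Icc, ← ENNReal.ofReal_mul (by positivity),
    ← ENNReal.ofReal_add (by positivity)
      (mul_nonneg (by positivity) (by linarith))]
  apply le_of_eq
  congr 1
  rw [hE]
  field_simp
  ring

/-- The contribution of `|ξ₂| > ξ / 2`, where the phase is transversal in `ξ₂`. -/
lemma lintegral_relSymbol_high_le {s ε ξ α M : ℝ} (hs : 0 < s) (hε : 0 ≤ ε) (hεs : ε ≤ s)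
    (hξ : 1 ≤ ξ) (hM : 0 ≤ M) :
    ∫⁻ u, ∫⁻ t, (if ξ < u ∧ ξ / 2 < |t| ∧ |Φbo ξ u t - α| < M then
      ENNReal.ofReal (relSymbol s ε ξ u t ^ 2) else 0) ≤
    ENNReal.ofReal (8 * 4 ^ (s + 1) * 4 ^ ε * M / (2 * s)) := by
  have hξ0 : 0 < ξ := by linarith
  set D := 8 * 4 ^ (s + 1) * 4 ^ ε * M with hD
  have hD0 : 0 ≤ D := by positivity
  have inner : ∀ u, ∫⁻ t, (if ξ < u ∧ ξ / 2 < |t| ∧ |Φbo ξ u t - α| < M then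
      ENNReal.ofReal (relSymbol s ε ξ u t ^ 2) else 0) ≤
      (Set.Ioi ξ).indicator
        (fun u => ENNReal.ofReal (D * ξ ^ (2 * ε) * u ^ (-(2 * s) - 1))) u := by
    intro u
    by_cases hu : ξ < u
    · have hp := jap_pos ξ
      have hq := jap_pos u
      calc _ ≤ ∫⁻ t, {t : ℝ | ξ / 2 < |t| ∧ |Φbo ξ u t - α| < M}.indicator
            (fun _ => ENNReal.ofReal ((2 ^ (s + 1) * jap ξ ^ ε * jap u ^ (-s)) ^ 2)) t := by
            refine lintegral_mono fun t => ?_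
            dsimp only
            split_ifs with h
            · rw [Set.indicator_of_mem
                (show t ∈ {t : ℝ | ξ / 2 < |t| ∧ |Φbo ξ u t - α| < M} from h.2)]
              apply ENNReal.ofReal_le_ofReal
              exact pow_le_pow_left₀ (relSymbol_nonneg s ε ξ u t)
                (relSymbol_le_of_lt_abs hs.le hξ0 hu h.2.1) 2
            · exact zero_le
        _ ≤ ENNReal.ofReal ((2 ^ (s + 1) * jap ξ ^ ε * jap u ^ (-s)) ^ 2) *
            volume {t : ℝ | ξ / 2 < |t| ∧ |Φbo ξ u t - α| < M} := lintegral_indicator_const_le _ _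
        _ ≤ ENNReal.ofReal ((2 ^ (s + 1) * jap ξ ^ ε * jap u ^ (-s)) ^ 2) *
            ENNReal.ofReal (8 * M / u) := by
            gcongr
            exact volume_resonant_snd_le hξ0 hu
        _ ≤ _ := by
            rw [Set.indicator_of_mem (Set.mem_Ioi.2 hu), ← ENNReal.ofReal_mul (by positivity)]
            exact ENNReal.ofReal_le_ofReal (relSymbol_sq_mul_le hs.le hε hM hξ hu)
    · simp [hu]
  refine (lintegral_mono inner).trans ?_
  rw [lintegral_indicator measurableSet_Ioi,
    ← ofReal_integral_eq_lintegral_ofReal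
      ((integrableOn_Ioi_rpow_of_lt (by linarith) hξ0).const_mul _)
      ((ae_restrict_iff' measurableSet_Ioi).2 (Filter.Eventually.of_forall fun u hu => by
        have : 0 < u := hξ0.trans hu
        simp only [Pi.zero_apply]
        positivity)),
    integral_const_mul, integral_Ioi_rpow_of_lt (by linarith) hξ0]
  apply ENNReal.ofReal_le_ofReal
  rw [show -(2 * s) - 1 + 1 = -(2 * s) by ring, neg_div_neg_eq]
  calc D * ξ ^ (2 * ε) * (ξ ^ (-(2 * s)) / (2 * s))
      = D / (2 * s) * ξ ^ (2 * ε + -(2 * s)) := by rw [Real.rpow_add hξ0]; ring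
    _ ≤ D / (2 * s) * 1 := by
      gcongr
      exact Real.rpow_le_one_of_one_le_of_nonpos hξ (by linarith)
    _ = _ := mul_one _

/-- The multiplier restricted to a level set of the resonance function. -/
noncomputable def restrictedSymbol (s ε α M ξ ξ₁ ξ₂ : ℝ) : ℝ≥0∞ :=
  if 1 < ξ ∧ ξ < ξ₁ ∧ |Φbo ξ ξ₁ ξ₂ - α| < M then ENNReal.ofReal (relSymbol s ε ξ ξ₁ ξ₂) else 0

lemma measurable_restrictedSymbol (s ε α M ξ : ℝ) :
    Measurable (Function.uncurry (restrictedSymbol s ε α M ξ)) := by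
  refine Measurable.ite ?_ (measurable_relSymbol s ε ξ).ennreal_ofReal measurable_const
  refine MeasurableSet.inter (s₁ := {z : ℝ × ℝ | 1 < ξ}) (MeasurableSet.const _)
    (MeasurableSet.inter (s₁ := {z : ℝ × ℝ | ξ < z.1})
      (s₂ := {z : ℝ × ℝ | |Φbo ξ z.1 z.2 - α| < M}) ?_ ?_)
  · exact (isOpen_lt (by fun_prop) (by fun_prop)).measurableSet
  · exact measurableSet_lt (continuous_abs.measurable.comp ((measurable_Φbo ξ).sub_const α))
      measurable_const

lemma exists_lintegral_restrictedSymbol_sq_le {s ε γ σ : ℝ} (hs : 0 < s) (hε : 0 ≤ ε)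
    (hγ0 : 0 ≤ γ) (hγ1 : γ ≤ 1) (h₁ : ε - 1 / 2 ≤ γ) (h₂ : 1 / 2 + ε - s ≤ 2 * γ) (hσs : σ ≤ s)
    (hσ1 : σ ≤ 1) (hεσ : ε ≤ σ) :
    ∃ C : ℝ, 0 < C ∧ ∀ α M ξ : ℝ, 1 < M →
      ∫⁻ u, ∫⁻ t, restrictedSymbol s ε α M ξ u t ^ 2 ≤
        ENNReal.ofReal (C * (|α| + M) ^ (2 * γ) * M) := by
  refine ⟨4 * π * 4 ^ s * 4 ^ (2 * γ) + 128 + 8 * 4 ^ (s + 1) * 4 ^ ε / (2 * s),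
    by positivity, fun α M ξ hM => ?_⟩
  by_cases hξ : 1 < ξ
  swap
  · simp [restrictedSymbol, hξ]
  have hle : ∀ u t, restrictedSymbol s ε α M ξ u t ^ 2 ≤
      (if |t| ≤ ξ / 2 ∧ ξ < u ∧ |Φbo ξ u t - α| < M then
        ENNReal.ofReal (relSymbol s ε ξ u t ^ 2) else 0) +
      (if ξ < u ∧ ξ / 2 < |t| ∧ |Φbo ξ u t - α| < M then
        ENNReal.ofReal (relSymbol s ε ξ u t ^ 2) else 0) := by
    intro u t
    unfold restrictedSymbol
    rw [ENNReal.ofReal_pow (relSymbol_nonneg s ε ξ u t)]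
    by_cases hP : ξ < u ∧ |Φbo ξ u t - α| < M
    · rcases le_or_gt |t| (ξ / 2) with ht | ht
      · simp [hξ, hP.1, hP.2, ht]
      · simp [hξ, hP.1, hP.2, ht]
    · simp [hP]
  have hmeas : ∀ u, Measurable fun t => if |t| ≤ ξ / 2 ∧ ξ < u ∧ |Φbo ξ u t - α| < M then
      ENNReal.ofReal (relSymbol s ε ξ u t ^ 2) else 0 := by
    intro u
    have hΦm : Measurable fun t => Φbo ξ u t :=
      (measurable_Φbo ξ).comp (measurable_const.prodMk measurable_id)
    have hSm : Measurable fun t => relSymbol s ε ξ u t :=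
      (measurable_relSymbol s ε ξ).comp (measurable_const.prodMk measurable_id)
    refine Measurable.ite ?_ (hSm.pow_const 2).ennreal_ofReal measurable_const
    refine MeasurableSet.inter (s₁ := {t : ℝ | |t| ≤ ξ / 2}) ?_
      (MeasurableSet.inter (s₁ := {t : ℝ | ξ < u})
        (s₂ := {t : ℝ | |Φbo ξ u t - α| < M}) (MeasurableSet.const _) ?_)
    · exact (isClosed_le (by fun_prop) (by fun_prop)).measurableSet
    · exact measurableSet_lt (continuous_abs.measurable.comp (hΦm.sub_const α)) measurable_const
  have hA : 1 ≤ |α| + M := by linarith [abs_nonneg α]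
  have hA1 : 1 ≤ (|α| + M) ^ (2 * γ) := Real.one_le_rpow hA (by linarith)
  calc _ ≤ ∫⁻ u, ∫⁻ t, ((if |t| ≤ ξ / 2 ∧ ξ < u ∧ |Φbo ξ u t - α| < M then
        ENNReal.ofReal (relSymbol s ε ξ u t ^ 2) else 0) +
      (if ξ < u ∧ ξ / 2 < |t| ∧ |Φbo ξ u t - α| < M then
        ENNReal.ofReal (relSymbol s ε ξ u t ^ 2) else 0)) :=
        lintegral_mono fun u => lintegral_mono fun t => hle u t
    _ = (∫⁻ u, ∫⁻ t, (if |t| ≤ ξ / 2 ∧ ξ < u ∧ |Φbo ξ u t - α| < M then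
        ENNReal.ofReal (relSymbol s ε ξ u t ^ 2) else 0)) +
      ∫⁻ u, ∫⁻ t, (if ξ < u ∧ ξ / 2 < |t| ∧ |Φbo ξ u t - α| < M then
        ENNReal.ofReal (relSymbol s ε ξ u t ^ 2) else 0) := by
      rw [lintegral_congr fun u => lintegral_add_left (hmeas u) _, lintegral_add_left]
      refine Measurable.lintegral_prod_right' (f := fun z : ℝ × ℝ =>
        if |z.2| ≤ ξ / 2 ∧ ξ < z.1 ∧ |Φbo ξ z.1 z.2 - α| < M then
          ENNReal.ofReal (relSymbol s ε ξ z.1 z.2 ^ 2) else 0) ?_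
      refine Measurable.ite ?_ ((measurable_relSymbol s ε ξ).pow_const 2).ennreal_ofReal
        measurable_const
      refine MeasurableSet.inter (s₁ := {z : ℝ × ℝ | |z.2| ≤ ξ / 2}) ?_
        (MeasurableSet.inter (s₁ := {z : ℝ × ℝ | ξ < z.1})
          (s₂ := {z : ℝ × ℝ | |Φbo ξ z.1 z.2 - α| < M}) ?_ ?_)
      · exact (isClosed_le (by fun_prop) (by fun_prop)).measurableSet
      · exact (isOpen_lt (by fun_prop) (by fun_prop)).measurableSet
      · exact measurableSet_lt
          (continuous_abs.measurable.comp ((measurable_Φbo ξ).sub_const α)) measurable_const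
    _ ≤ _ := add_le_add
      (lintegral_relSymbol_low_le hs.le hγ0 hγ1 h₁ h₂ hσs hσ1 hεσ hξ.le (by linarith))
      (lintegral_relSymbol_high_le hs hε (by linarith) hξ.le (by linarith))
    _ ≤ _ := by
      rw [← ENNReal.ofReal_add (by positivity) (by positivity)]
      apply ENNReal.ofReal_le_ofReal
      rw [Real.mul_rpow (by norm_num) (by linarith)]
      have h3 : 0 ≤ (128 + 8 * 4 ^ (s + 1) * 4 ^ ε / (2 * s)) * M := by positivity
      have := mul_le_mul_of_nonneg_left hA1 h3
      calc _ = 4 * π * 4 ^ s * (4 ^ (2 * γ) * (|α| + M) ^ (2 * γ)) * M +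
            (128 + 8 * 4 ^ (s + 1) * 4 ^ ε / (2 * s)) * M * 1 := by ring
        _ ≤ _ := add_le_add_right this _
        _ = _ := by ring

/-- Frequency-restricted estimate for the cubic nonlinearity `C₊` of the gauged
Benjamin–Ono equation, `H^{s+1}`-version with an `ε` gain of regularity. -/
theorem frequency_restricted_cubic (s ε : ℝ) (hs : 0 < s) (hε0 : 0 ≤ ε)
    (hε : ε < min s (3 / 4)) (γ : ℝ)
    (hγ : γ = max (max (1 / 4 + (ε - s) / 2) (ε - 1 / 2)) 0) :
    ∃ C : ℝ, 0 < C ∧ ∀ (α M : ℝ) (f₁ f₂ f₃ : ℝ → ℂ), 1 < M →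
      Measurable f₁ → Measurable f₂ → Measurable f₃ →
      sobNorm (s + 1) f₁ < ⊤ → sobNorm (s + 1) f₂ < ⊤ → sobNorm (s + 1) f₃ < ⊤ →
      sobNorm (s + ε + 1) (fun ξ : ℝ =>
        if 1 < ξ then
          ∫ ξ₁ : ℝ, ∫ ξ₂ : ℝ,
            (if ξ < ξ₁ ∧ |Φbo ξ ξ₁ ξ₂ - α| < M then
              (((ξ₂ + (ξ - ξ₁ - ξ₂)) * (ξ - ξ₁ - ξ₂) : ℝ) : ℂ) *
                f₁ ξ₁ * f₂ ξ₂ * f₃ (ξ - ξ₁ - ξ₂)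
            else 0)
        else 0)
      ≤ ENNReal.ofReal (C * (|α| + M) ^ γ * M ^ (1 / 2 : ℝ)) *
          sobNorm (s + 1) f₁ * sobNorm (s + 1) f₂ * sobNorm (s + 1) f₃ := by
  obtain ⟨hεs, hε34⟩ := lt_min_iff.1 hε
  have hγ0 : 0 ≤ γ := hγ ▸ le_max_right _ _
  have hγa : 1 / 4 + (ε - s) / 2 ≤ γ := hγ ▸ (le_max_left _ _).trans (le_max_left _ _)
  have hγb : ε - 1 / 2 ≤ γ := hγ ▸ (le_max_right _ _).trans (le_max_left _ _)
  have hγ1 : γ ≤ 1 := by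
    rw [hγ]
    exact max_le (max_le (by linarith) (by linarith)) (by norm_num)
  obtain ⟨C, hC, hmain⟩ := exists_lintegral_restrictedSymbol_sq_le (σ := min s (3 / 4)) hs hε0 hγ0
    hγ1 hγb (by linarith) (min_le_left _ _) ((min_le_right _ _).trans (by norm_num)) hε.le
  refine ⟨C ^ (1 / 2 : ℝ), by positivity, fun α M f₁ f₂ f₃ hM hf₁ hf₂ hf₃ _ _ _ => ?_⟩
  have hA : 0 ≤ |α| + M := by linarith [abs_nonneg α]
  have hF : ∀ f : ℝ → ℂ, Measurable f →
      Measurable fun x => ENNReal.ofReal (jap x ^ (s + 1)) * ‖f x‖ₑ := fun f hf =>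
    ((measurable_jap.pow_const _).ennreal_ofReal).mul hf.enorm
  have htri := lintegral_sq_trilinear_le (measurable_restrictedSymbol s ε α M) (hF f₁ hf₁)
    (hF f₂ hf₂) (hF f₃ hf₃) (fun ξ => hmain α M ξ hM)
  have hpt : ∀ ξ, ENNReal.ofReal (jap ξ ^ (s + ε + 1)) * ‖(if 1 < ξ then
          ∫ ξ₁ : ℝ, ∫ ξ₂ : ℝ,
            (if ξ < ξ₁ ∧ |Φbo ξ ξ₁ ξ₂ - α| < M then
              (((ξ₂ + (ξ - ξ₁ - ξ₂)) * (ξ - ξ₁ - ξ₂) : ℝ) : ℂ) *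
                f₁ ξ₁ * f₂ ξ₂ * f₃ (ξ - ξ₁ - ξ₂)
            else 0)
        else 0)‖ₑ ≤
      ∫⁻ ξ₁, ∫⁻ ξ₂, restrictedSymbol s ε α M ξ ξ₁ ξ₂ *
        (ENNReal.ofReal (jap ξ₁ ^ (s + 1)) * ‖f₁ ξ₁‖ₑ *
        (ENNReal.ofReal (jap ξ₂ ^ (s + 1)) * ‖f₂ ξ₂‖ₑ) *
        (ENNReal.ofReal (jap (ξ - ξ₁ - ξ₂) ^ (s + 1)) * ‖f₃ (ξ - ξ₁ - ξ₂)‖ₑ)) := by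
    intro ξ
    by_cases hξ : 1 < ξ
    swap
    · simp [hξ]
    rw [if_pos hξ]
    refine (mul_le_mul_right ((enorm_integral_le_lintegral_enorm _).trans
      (lintegral_mono fun ξ₁ => enorm_integral_le_lintegral_enorm _)) _).trans ?_
    rw [← lintegral_const_mul' _ _ ENNReal.ofReal_ne_top]
    refine lintegral_mono fun ξ₁ => ?_
    dsimp only
    rw [← lintegral_const_mul' _ _ ENNReal.ofReal_ne_top]
    refine lintegral_mono fun ξ₂ => ?_
    dsimp only
    unfold restrictedSymbol
    by_cases hP : ξ < ξ₁ ∧ |Φbo ξ ξ₁ ξ₂ - α| < M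
    · rw [if_pos hP, if_pos ⟨hξ, hP⟩, enorm_mul_eq_ofReal_relSymbol]
    · simp [hP]
  simp only [sobNorm_eq]
  refine (ENNReal.rpow_le_rpow ((lintegral_mono fun ξ => pow_le_pow_left' (hpt ξ) 2).trans htri)
    (by norm_num : (0 : ℝ) ≤ 1 / 2)).trans_eq ?_
  have hhalf : (0 : ℝ) ≤ 1 / 2 := by norm_num
  rw [ENNReal.mul_rpow_of_nonneg _ _ hhalf, ENNReal.mul_rpow_of_nonneg _ _ hhalf,
    ENNReal.mul_rpow_of_nonneg _ _ hhalf, ENNReal.ofReal_rpow_of_nonneg (by positivity) hhalf,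
    Real.mul_rpow (by positivity) (by linarith), Real.mul_rpow hC.le (by positivity),
    ← Real.rpow_mul hA, show 2 * γ * (1 / 2) = γ by ring]
  simp only [mul_assoc]
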